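/- Let K, L ∈ ℕ, let α ∈ 𝒞_{K,L} with associated increasing sequence (n_k) and constant c > 0 satisfying the diophantine condition a_{n_k+1−n} ≤ e^{cn} for 1 ≤ n ≤ n_k and 100(K²+L²) < a_{n_k+1} < 200(K²+L²), and let f(x) = -log x - log(1-x) + g(x) with g ∈ C³(𝕋). For every c'' > 0 there exists a constant C'' > 0 such that for every k ∈ ℕ and every x ∈ 𝕋 satisfying {x, x+α, …, x+(q_{n_k}−1)α} ∩ [−c''/q_{n_k}, c''/q_{n_k}] = ∅ (as subsets of 𝕋), and for every natural number ℓ with 0 ≤ ℓ ≤ q_{n_k}: |S_ℓ(f')(x)| ≤ C''·q_{n_k}. -/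

import Mathlib

open MeasureTheory Filter Topology

noncomputable section

/-- Iterates of the Gauss map applied to the fractional part of `α`. -/
def gaussIter (α : ℝ) (n : ℕ) : ℝ := (fun x : ℝ => Int.fract x⁻¹)^[n] (Int.fract α)

/-- The `n`-th partial quotient `a_n` of the continued fraction expansion of `α`
(for `n ≥ 1`). -/
def cfA (α : ℝ) (n : ℕ) : ℕ := ⌊(gaussIter α (n - 1))⁻¹⌋₊

/-- The denominators `q_n` of the convergents of the continued fraction of `α`:
`q₀ = 1`, `q₁ = a₁`, `q_{n+1} = a_{n+1} q_n + q_{n-1}`. -/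
def cfQ (α : ℝ) : ℕ → ℕ
  | 0 => 1
  | 1 => cfA α 1
  | n + 2 => cfA α (n + 2) * cfQ α (n + 1) + cfQ α n

/-- Birkhoff sums over the rotation by `α`: `S_n(φ)(x) = ∑_{i<n} φ(x + iα)`. -/
def birkhoffRot (α : ℝ) (φ : ℝ → ℝ) (n : ℕ) (x : ℝ) : ℝ :=
  ∑ i ∈ Finset.range n, φ (x + i * α)

/-- Distance to the nearest integer, `‖x‖ = min(x mod 1, 1 - x mod 1)`. -/
def distNearestInt (x : ℝ) : ℝ := min (Int.fract x) (1 - Int.fract x)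

/-- Outside at most `e` indices, the orbit sum of `φ` of length `l` is at most `B`. -/
def SumExcept (φ : ℝ → ℝ) (α : ℝ) (l e : ℕ) (B y : ℝ) : Prop :=
  ∃ E ⊆ Finset.range l, E.card ≤ e ∧ |∑ i ∈ Finset.range l \ E, φ (y + i * α)| ≤ B

/-- The singular part `1 / (1 - {y}) - 1 / {y}` of the derivative. -/
def oddPole (y : ℝ) : ℝ := 1 / (1 - Int.fract y) - 1 / Int.fract y

/-- Numerators of the convergents of the continued fraction of `α ∈ (0, 1)`. -/
def cfP (α : ℝ) : ℕ → ℤ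
  | 0 => 0
  | 1 => 1
  | n + 2 => cfA α (n + 2) * cfP α (n + 1) + cfP α n

section ContinuedFraction

variable {α : ℝ}

lemma gaussIter_succ (α : ℝ) (n : ℕ) :
    gaussIter α (n + 1) = Int.fract (gaussIter α n)⁻¹ := by
  simp only [gaussIter, Function.iterate_succ_apply']

lemma irrational_fract {x : ℝ} (h : Irrational x) : Irrational (Int.fract x) := by
  rw [← Int.self_sub_floor]
  exact h.sub_intCast _

lemma irrational_gaussIter (hirr : Irrational α) (n : ℕ) : Irrational (gaussIter α n) := by
  induction n with
  | zero => exact irrational_fract hirr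
  | succ n ih =>
    rw [gaussIter_succ]
    exact irrational_fract ih.inv

lemma gaussIter_pos (hirr : Irrational α) (n : ℕ) : 0 < gaussIter α n := by
  refine lt_of_le_of_ne ?_ (irrational_gaussIter hirr n).ne_zero.symm
  cases n with
  | zero => exact Int.fract_nonneg _
  | succ n => rw [gaussIter_succ]; exact Int.fract_nonneg _

lemma gaussIter_lt_one (α : ℝ) (n : ℕ) : gaussIter α n < 1 := by
  cases n with
  | zero => exact Int.fract_lt_one _
  | succ n => rw [gaussIter_succ]; exact Int.fract_lt_one _

lemma gaussIter_inv (hirr : Irrational α) (n : ℕ) :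
    (gaussIter α n)⁻¹ = cfA α (n + 1) + gaussIter α (n + 1) := by
  rw [gaussIter_succ, cfA, Nat.add_sub_cancel,
    natCast_floor_eq_intCast_floor (inv_pos.2 (gaussIter_pos hirr n)).le, Int.floor_add_fract]

lemma one_le_cfA (hirr : Irrational α) (n : ℕ) : 1 ≤ cfA α (n + 1) := by
  rw [cfA, Nat.add_sub_cancel, Nat.one_le_floor_iff]
  exact (one_le_inv₀ (gaussIter_pos hirr n)).2 (gaussIter_lt_one α n).le

lemma cfQ_pos (hirr : Irrational α) : ∀ n, 1 ≤ cfQ α n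
  | 0 => le_rfl
  | 1 => one_le_cfA hirr 0
  | n + 2 => by
    rw [cfQ]
    exact le_add_left (cfQ_pos hirr n)

lemma cfQ_add_le (hirr : Irrational α) (n : ℕ) :
    cfQ α (n + 1) + cfQ α n ≤ cfQ α (n + 2) := by
  rw [cfQ]
  exact Nat.add_le_add_right (Nat.le_mul_of_pos_left _ (one_le_cfA hirr (n + 1))) _

lemma cfQ_le_succ (hirr : Irrational α) (n : ℕ) : cfQ α n ≤ cfQ α (n + 1) := by
  cases n with
  | zero => exact cfQ_pos hirr 1
  | succ n => exact le_trans (Nat.le_add_right _ _) (cfQ_add_le hirr n)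

lemma cfQ_succ_le (hirr : Irrational α) (n : ℕ) :
    cfQ α (n + 1) ≤ (cfA α (n + 1) + 1) * cfQ α n := by
  cases n with
  | zero => simp [cfQ]
  | succ n =>
    rw [cfQ, add_mul, one_mul]
    exact Nat.add_le_add_left (cfQ_le_succ hirr n) _

lemma convergent_error_succ (hirr : Irrational α) (hα : α ∈ Set.Ioo (0 : ℝ) 1) (n : ℕ) :
    cfQ α (n + 1) * α - cfP α (n + 1) =
      -gaussIter α (n + 1) * (cfQ α n * α - cfP α n) := by
  induction n with
  | zero =>
    have h0 : gaussIter α 0 = α := Int.fract_eq_self.2 ⟨hα.1.le, hα.2⟩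
    have h := gaussIter_inv hirr 0
    rw [h0] at h
    have hne := hα.1.ne'
    simp only [zero_add] at h ⊢
    have : (cfA α 1 : ℝ) = α⁻¹ - gaussIter α 1 := by linarith
    simp only [cfQ, cfP, this]
    push_cast
    field_simp
    ring
  | succ n ih =>
    have h := gaussIter_inv hirr (n + 1)
    have hne := (gaussIter_pos hirr (n + 1)).ne'
    have h2 : (cfA α (n + 2) : ℝ) = (gaussIter α (n + 1))⁻¹ - gaussIter α (n + 2) := by
      linarith
    have h3 : (cfQ α n * α - cfP α n : ℝ) =
        -(gaussIter α (n + 1))⁻¹ * (cfQ α (n + 1) * α - cfP α (n + 1)) := by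
      rw [ih]; field_simp
    have h4 : (cfQ α (n + 2) * α - cfP α (n + 2) : ℝ) =
        cfA α (n + 2) * (cfQ α (n + 1) * α - cfP α (n + 1)) + (cfQ α n * α - cfP α n) := by
      simp only [cfQ, cfP]; push_cast; ring
    rw [h4, h3, h2]; ring

lemma convergent_det (α : ℝ) (n : ℕ) :
    (cfQ α n : ℤ) * cfP α (n + 1) - cfQ α (n + 1) * cfP α n = (-1) ^ n := by
  induction n with
  | zero => simp [cfQ, cfP]
  | succ n ih =>
    simp only [cfQ, cfP, pow_succ, ← ih]; push_cast; ring

lemma convergent_coprime (α : ℝ) (n : ℕ) : IsCoprime (cfP α n) (cfQ α n : ℤ) := by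
  have h1 : ((-1 : ℤ) ^ n) * (-1) ^ n = 1 := by rw [← mul_pow]; simp
  exact ⟨-(-1) ^ n * cfQ α (n + 1), (-1) ^ n * cfP α (n + 1), by
    linear_combination (-1) ^ n * convergent_det α n + h1⟩

lemma convergent_error_sign (hirr : Irrational α) (hα : α ∈ Set.Ioo (0 : ℝ) 1) (n : ℕ) :
    0 < (-1) ^ n * (cfQ α n * α - cfP α n) := by
  induction n with
  | zero => simpa [cfQ, cfP] using hα.1
  | succ n ih =>
    rw [convergent_error_succ hirr hα, pow_succ]
    have := mul_pos (gaussIter_pos hirr (n + 1)) ih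
    linarith

lemma convergent_error_relation (α : ℝ) (n : ℕ) :
    cfQ α (n + 1) * ((-1) ^ n * (cfQ α n * α - cfP α n)) +
      cfQ α n * ((-1) ^ (n + 1) * (cfQ α (n + 1) * α - cfP α (n + 1))) = (1 : ℝ) := by
  have h1 : ((-1 : ℝ) ^ n) * (-1) ^ n = 1 := by rw [← mul_pow]; simp
  have h := congrArg (fun z : ℤ => (z : ℝ)) (convergent_det α n)
  push_cast at h
  rw [pow_succ]
  linear_combination (-1) ^ n * h + h1

lemma abs_convergent_error_le (hirr : Irrational α) (hα : α ∈ Set.Ioo (0 : ℝ) 1) (n : ℕ) :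
    |cfQ α n * α - cfP α n| ≤ 1 / (cfQ α n : ℝ) := by
  have h1 := convergent_error_sign hirr hα n
  have h2 := convergent_error_sign hirr hα (n + 1)
  have h3 := convergent_error_relation α n
  have hq : (1 : ℝ) ≤ cfQ α n := by exact_mod_cast cfQ_pos hirr n
  have hq' : (cfQ α n : ℝ) ≤ cfQ α (n + 1) := by exact_mod_cast cfQ_le_succ hirr n
  have h4 : |cfQ α n * α - cfP α n| = (-1) ^ n * (cfQ α n * α - cfP α n) := by
    rw [← abs_of_pos h1, abs_mul]; simp
  rw [h4, le_div_iff₀ (by linarith)]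
  nlinarith

/-- Best approximation: multiples `iα` with `0 < i < q_{n+1}` stay `1 / (2 q_{n+1})` away
from the integers. -/
lemma le_abs_mul_sub_int (hirr : Irrational α) (hα : α ∈ Set.Ioo (0 : ℝ) 1) (n : ℕ)
    {i r : ℤ} (hi : 0 < i) (hi' : i < cfQ α (n + 1)) :
    1 / (2 * cfQ α (n + 1) : ℝ) ≤ |i * α - r| := by
  have h1 := convergent_error_sign hirr hα n
  have h2 := convergent_error_sign hirr hα (n + 1)
  have h3 := convergent_error_relation α n
  have hg := gaussIter_lt_one α (n + 1)
  have hs := convergent_error_succ hirr hα n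
  have hq : (1 : ℤ) ≤ cfQ α n := by exact_mod_cast cfQ_pos hirr n
  have hq' : (cfQ α n : ℤ) ≤ cfQ α (n + 1) := by exact_mod_cast cfQ_le_succ hirr n
  have hqR : (1 : ℝ) ≤ cfQ α n := by exact_mod_cast hq
  have hqR' : (cfQ α n : ℝ) ≤ cfQ α (n + 1) := by exact_mod_cast hq'
  have hdet := convergent_det α n
  have hsq : ((-1 : ℤ) ^ n) * (-1) ^ n = 1 := by rw [← mul_pow]; simp
  set d : ℝ := (-1) ^ n * (cfQ α n * α - cfP α n) with hd
  set d' : ℝ := (-1) ^ (n + 1) * (cfQ α (n + 1) * α - cfP α (n + 1)) with hd'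
  set u : ℤ := (-1) ^ n * (i * cfP α (n + 1) - r * cfQ α (n + 1)) with hu
  set v : ℤ := (-1) ^ n * (r * cfQ α n - i * cfP α n) with hv
  have e1 : u * cfQ α n + v * cfQ α (n + 1) = i := by
    linear_combination (-1) ^ n * i * hdet + i * hsq
  have e2 : u * cfP α n + v * cfP α (n + 1) = r := by
    linear_combination (-1) ^ n * r * hdet + r * hsq
  have hdd : d' ≤ d := by
    have : d' = gaussIter α (n + 1) * d := by rw [hd', hs, hd, pow_succ]; ring
    rw [this]; nlinarith
  have hdlow : 1 / (2 * cfQ α (n + 1) : ℝ) ≤ d := by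
    rw [div_le_iff₀ (by linarith)]
    nlinarith
  have habs : |i * α - r| = |u * d - v * d'| := by
    have hR : (i * α - r : ℝ) = (-1) ^ n * (u * d - v * d') := by
      have hsqR : ((-1 : ℝ) ^ n) * (-1) ^ n = 1 := by rw [← mul_pow]; simp
      have e1R : (u * cfQ α n + v * cfQ α (n + 1) : ℝ) = i := by exact_mod_cast e1
      have e2R : (u * cfP α n + v * cfP α (n + 1) : ℝ) = r := by exact_mod_cast e2
      rw [← e1R, ← e2R, hd, hd', pow_succ]
      linear_combination (-(u * (cfQ α n * α - cfP α n)
        + v * (cfQ α (n + 1) * α - cfP α (n + 1)))) * hsqR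
    rw [hR, abs_mul]; simp
  rw [habs]
  refine hdlow.trans ?_
  rcases lt_trichotomy u 0 with hu0 | hu0 | hu0
  · have hv0 : 0 ≤ v := by
      by_contra hcon
      nlinarith
    have : (u : ℝ) ≤ -1 := by exact_mod_cast (by omega : u ≤ -1)
    have : (0 : ℝ) ≤ v := by exact_mod_cast hv0
    rw [le_abs]; right; nlinarith
  · exfalso
    rw [hu0, zero_mul, zero_add] at e1
    rcases le_or_gt v 0 with hv0 | hv0 <;> nlinarith
  · have hv0 : v ≤ 0 := by
      by_contra hcon
      nlinarith
    have : (1 : ℝ) ≤ u := by exact_mod_cast (by omega : 1 ≤ u)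
    have : (v : ℝ) ≤ 0 := by exact_mod_cast hv0
    rw [le_abs]; left; nlinarith

lemma sum_cfQ_le (hirr : Irrational α) (n : ℕ) :
    ∑ j ∈ Finset.range n, cfQ α (j + 1) ≤ 3 * cfQ α n := by
  induction n using Nat.twoStepInduction with
  | zero => simp
  | one => simp; omega
  | more n ih _ =>
    rw [Finset.sum_range_succ, Finset.sum_range_succ]
    have := cfQ_add_le hirr n
    have := cfQ_le_succ hirr n
    simp only [add_assoc, Nat.reduceAdd] at *
    omega

lemma sum_weighted_cfQ_le (hirr : Irrational α) (n : ℕ) :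
    ∑ j ∈ Finset.range n, ((n : ℝ) - j) * cfQ α (j + 1) ≤ 9 * cfQ α n := by
  have key : ∀ n : ℕ, ∑ j ∈ Finset.range n, ((n : ℝ) - j) * cfQ α (j + 1) ≤
      3 * ∑ j ∈ Finset.range n, (cfQ α (j + 1) : ℝ) := by
    intro n
    induction n with
    | zero => simp
    | succ n ih =>
      have h : (∑ j ∈ Finset.range (n + 1), (cfQ α (j + 1) : ℝ)) ≤ 3 * cfQ α (n + 1) := by
        exact_mod_cast sum_cfQ_le hirr (n + 1)
      have e : ∑ j ∈ Finset.range (n + 1), (((n + 1 : ℕ) : ℝ) - j) * cfQ α (j + 1) =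
          ∑ j ∈ Finset.range n, ((n : ℝ) - j) * cfQ α (j + 1) +
            ∑ j ∈ Finset.range (n + 1), (cfQ α (j + 1) : ℝ) := by
        rw [Finset.sum_range_succ, Finset.sum_range_succ, ← add_assoc,
          ← Finset.sum_add_distrib]
        congr 1
        · exact Finset.sum_congr rfl fun j _ => by push_cast; ring
        · push_cast; ring
      rw [e]
      rw [Finset.sum_range_succ] at h ⊢
      linarith
  have h : (∑ j ∈ Finset.range n, (cfQ α (j + 1) : ℝ)) ≤ 3 * cfQ α n := by
    exact_mod_cast sum_cfQ_le hirr n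
  linarith [key n]

end ContinuedFraction

section SumExcept

variable {φ : ℝ → ℝ} {α : ℝ}

lemma SumExcept.append {l l' e e' : ℕ} {B B' y : ℝ} (h : SumExcept φ α l e B y)
    (h' : SumExcept φ α l' e' B' (y + l * α)) :
    SumExcept φ α (l + l') (e + e') (B + B') y := by
  obtain ⟨E, hE, hc, hs⟩ := h
  obtain ⟨E', hE', hc', hs'⟩ := h'
  have hdis : ∀ (S T : Finset ℕ), S ⊆ Finset.range l →
      Disjoint S (T.map (addLeftEmbedding l)) := by
    intro S T hS
    rw [Finset.disjoint_left]
    intro a ha hb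
    have := Finset.mem_range.1 (hS ha)
    obtain ⟨b, -, rfl⟩ := Finset.mem_map.1 hb
    simp at this
  have hrange : Finset.range (l + l') \ (E ∪ E'.map (addLeftEmbedding l)) =
      (Finset.range l \ E) ∪ (Finset.range l' \ E').map (addLeftEmbedding l) := by
    ext a
    simp only [Finset.mem_sdiff, Finset.mem_union, Finset.mem_range, Finset.mem_map,
      addLeftEmbedding_apply]
    constructor
    · rintro ⟨h1, h2⟩
      push Not at h2
      rcases lt_or_ge a l with h3 | h3
      · exact Or.inl ⟨h3, h2.1⟩
      · exact Or.inr ⟨a - l, ⟨by omega, fun h4 => h2.2 _ h4 (by omega)⟩, by omega⟩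
    · rintro (⟨h1, h2⟩ | ⟨b, ⟨h1, h2⟩, rfl⟩)
      · refine ⟨by omega, ?_⟩
        rintro (h3 | ⟨b, -, rfl⟩)
        · exact h2 h3
        · omega
      · refine ⟨by omega, ?_⟩
        rintro (h3 | ⟨b', h3, h4⟩)
        · have := Finset.mem_range.1 (hE h3); omega
        · exact h2 (by rwa [Nat.add_left_cancel h4] at h3)
  refine ⟨E ∪ E'.map (addLeftEmbedding l), ?_, ?_, ?_⟩
  · intro a ha
    rcases Finset.mem_union.1 ha with ha | ha
    · have := Finset.mem_range.1 (hE ha); exact Finset.mem_range.2 (by omega)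
    · obtain ⟨b, hb, rfl⟩ := Finset.mem_map.1 ha
      have := Finset.mem_range.1 (hE' hb)
      exact Finset.mem_range.2 (by simpa using this)
  · refine (Finset.card_union_le _ _).trans ?_
    rw [Finset.card_map]
    omega
  · rw [hrange, Finset.sum_union (hdis _ _ Finset.sdiff_subset), Finset.sum_map]
    refine (abs_add_le _ _).trans (add_le_add hs (le_of_eq_of_le ?_ hs'))
    congr 1
    refine Finset.sum_congr rfl fun i _ => ?_
    simp only [addLeftEmbedding_apply]
    congr 1
    push_cast
    ring

lemma SumExcept.of_blocks {q e : ℕ} {B : ℝ} (h : ∀ y, SumExcept φ α q e B y) (b : ℕ) (y : ℝ) :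
    SumExcept φ α (b * q) (b * e) (b * B) y := by
  induction b with
  | zero => exact ⟨∅, by simp, by simp, by simp⟩
  | succ b ih =>
    have := ih.append (h _)
    convert this using 1
    · ring
    · ring
    · push_cast; ring

end SumExcept

lemma card_separated_le {E : Finset ℕ} {s : ℕ → ℝ} {δ r : ℝ} (hδ : 0 < δ) {N : ℕ}
    (hE : E.card = N + 1)
    (hsep : ∀ i ∈ E, ∀ j ∈ E, i ≠ j → δ ≤ |s i - s j|) (hr : ∀ i ∈ E, |s i| ≤ r) :
    N * δ ≤ 2 * r := by
  have hnn : ∀ i ∈ E, 0 ≤ (s i + r) / δ := fun i hi =>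
    div_nonneg (by linarith [(abs_le.1 (hr i hi)).1]) hδ.le
  have hinj : Set.InjOn (fun i => ⌊(s i + r) / δ⌋₊) E := by
    intro i hi j hj hij
    by_contra hne
    have h1 := hsep i hi j hj hne
    have h2 : |(s i + r) / δ - (s j + r) / δ| < 1 := by
      have a1 := Nat.floor_le (hnn i hi)
      have a2 := Nat.lt_floor_add_one ((s i + r) / δ)
      have a3 := Nat.floor_le (hnn j hj)
      have a4 := Nat.lt_floor_add_one ((s j + r) / δ)
      simp only at hij
      rw [hij] at a1 a2
      rw [abs_lt]
      constructor <;> linarith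
    rw [← sub_div, abs_div, abs_of_pos hδ, div_lt_one hδ] at h2
    rw [show s i + r - (s j + r) = s i - s j by ring] at h2
    linarith
  have hmaps : Set.MapsTo (fun i => ⌊(s i + r) / δ⌋₊) E (Finset.range (⌊2 * r / δ⌋₊ + 1)) := by
    intro i hi
    rw [Finset.mem_coe, Finset.mem_range, Nat.lt_succ_iff]
    apply Nat.floor_le_floor
    gcongr
    linarith [(abs_le.1 (hr i hi)).2]
  have hcard := Finset.card_le_card_of_injOn _ hmaps hinj
  rw [hE, Finset.card_range] at hcard
  obtain ⟨i, hi⟩ : E.Nonempty := Finset.card_pos.1 (by omega)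
  have hr0 : 0 ≤ r := (abs_nonneg _).trans (hr i hi)
  have : (N : ℝ) ≤ 2 * r / δ :=
    (Nat.cast_le.2 (by omega : N ≤ ⌊2 * r / δ⌋₊)).trans (Nat.floor_le (by positivity))
  rwa [le_div_iff₀ hδ] at this

/-- Among `δ`-separated points, all but the one closest to `0` contribute at most
`(4 / δ)` times a harmonic sum to the sum of the inverse distances to `0`. -/
lemma exists_sum_separated_le {s w : ℕ → ℝ} {δ : ℝ} (hδ : 0 < δ)
    (hw : ∀ i, s i ≠ 0 → w i ≤ 1 / |s i|) (n : ℕ) (E : Finset ℕ) (hE : E.card = n)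
    (hsep : ∀ i ∈ E, ∀ j ∈ E, i ≠ j → δ ≤ |s i - s j|) :
    ∃ E' ⊆ E, E'.card ≤ 1 ∧ ∑ i ∈ E \ E', w i ≤ 4 / δ * (harmonic n : ℝ) := by
  induction n generalizing E with
  | zero => exact ⟨∅, by simp, by simp, by simp [Finset.card_eq_zero.1 hE]⟩
  | succ n ih =>
    rcases Nat.eq_zero_or_pos n with rfl | hn
    · refine ⟨E, subset_rfl, by omega, ?_⟩
      simp only [sdiff_self, Finset.bot_eq_empty, Finset.sum_empty]
      have : (0 : ℝ) ≤ (harmonic (0 + 1) : ℚ) := by simp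
      positivity
    obtain ⟨m, hm, hmax⟩ := E.exists_max_image (fun i => |s i|)
      (Finset.card_pos.1 (by omega))
    obtain ⟨E', hE', hc', hs'⟩ := ih (E.erase m) (by rw [Finset.card_erase_of_mem hm]; omega)
      fun i hi j hj => hsep i (Finset.mem_of_mem_erase hi) j (Finset.mem_of_mem_erase hj)
    refine ⟨E', hE'.trans (Finset.erase_subset _ _), hc', ?_⟩
    have hmE' : m ∉ E' := fun h => Finset.notMem_erase m E (hE' h)
    have hins : E \ E' = insert m (E.erase m \ E') := by
      ext a
      by_cases ha : a = m
      · subst ha; simp [hm, hmE']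
      · simp [ha]
    rw [hins, Finset.sum_insert (by simp), harmonic_succ]
    have hspread := card_separated_le hδ hE hsep hmax
    have hnR : (1 : ℝ) ≤ n := by exact_mod_cast hn
    have hpos : 0 < |s m| := by nlinarith
    have hwm : w m ≤ 4 / δ * ((n : ℝ) + 1)⁻¹ := by
      refine (hw m (abs_pos.1 hpos)).trans ?_
      rw [← div_eq_mul_inv, div_div, div_le_div_iff₀ hpos (by positivity)]
      nlinarith
    push_cast
    linarith

lemma abs_oddPole_le {y : ℝ} (h : y - round y ≠ 0) : |oddPole y| ≤ 1 / |y - round y| := by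
  have h1 := abs_pos.2 h
  rw [abs_sub_round_eq_min] at h1 ⊢
  have hf : 0 < Int.fract y := lt_of_lt_of_le h1 (min_le_left _ _)
  have hf' : 0 < 1 - Int.fract y := lt_of_lt_of_le h1 (min_le_right _ _)
  have b1 : 1 / Int.fract y ≤ 1 / min (Int.fract y) (1 - Int.fract y) :=
    one_div_le_one_div_of_le h1 (min_le_left _ _)
  have b2 : 1 / (1 - Int.fract y) ≤ 1 / min (Int.fract y) (1 - Int.fract y) :=
    one_div_le_one_div_of_le h1 (min_le_right _ _)
  have p1 := one_div_pos.2 hf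
  have p2 := one_div_pos.2 hf'
  rw [oddPole, abs_le]
  constructor <;> linarith

lemma SumExcept.reduce {α : ℝ} (hirr : Irrational α) (hα : α ∈ Set.Ioo (0 : ℝ) 1) {n l e : ℕ}
    {B y : ℝ} (hl : l ≤ cfQ α (n + 1)) (h : SumExcept oddPole α l e B y) :
    SumExcept oddPole α l 1 (B + 8 * cfQ α (n + 1) * (1 + Real.log (e + 1))) y := by
  obtain ⟨E, hE, hc, hs⟩ := h
  have hq : (1 : ℝ) ≤ cfQ α (n + 1) := by exact_mod_cast cfQ_pos hirr (n + 1)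
  have hsep : ∀ i ∈ E, ∀ j ∈ E, i ≠ j → 1 / (2 * cfQ α (n + 1) : ℝ) ≤
      |(y + i * α - round (y + i * α)) - (y + j * α - round (y + j * α))| := by
    have key : ∀ i ∈ E, ∀ j ∈ E, j < i → 1 / (2 * cfQ α (n + 1) : ℝ) ≤
        |(y + i * α - round (y + i * α)) - (y + j * α - round (y + j * α))| := by
      intro i hi j hj hij
      have hi' := Finset.mem_range.1 (hE hi)
      have := le_abs_mul_sub_int hirr hα n (i := (i : ℤ) - j)
        (r := round (y + i * α) - round (y + j * α)) (by omega) (by omega)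
      refine this.trans_eq ?_
      congr 1
      push_cast
      ring
    intro i hi j hj hij
    rcases lt_or_gt_of_ne hij with h1 | h1
    · rw [abs_sub_comm]; exact key j hj i hi h1
    · exact key i hi j hj h1
  obtain ⟨E', hE', hc', hs'⟩ := exists_sum_separated_le (w := fun i => |oddPole (y + i * α)|)
    (by positivity) (fun i hi => abs_oddPole_le hi) E.card E rfl hsep
  refine ⟨E', hE'.trans hE, hc', ?_⟩
  have hsplit : ∑ i ∈ Finset.range l \ E', oddPole (y + i * α) =
      ∑ i ∈ Finset.range l \ E, oddPole (y + i * α) + ∑ i ∈ E \ E', oddPole (y + i * α) := by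
    rw [← Finset.sum_union]
    · congr 1
      exact (Finset.sdiff_union_sdiff_cancel hE hE').symm
    · exact Finset.sdiff_disjoint.mono_right Finset.sdiff_subset
  rw [hsplit]
  refine (abs_add_le _ _).trans (add_le_add hs ?_)
  refine (Finset.abs_sum_le_sum_abs _ _).trans (hs'.trans ?_)
  have hh : (harmonic E.card : ℝ) ≤ 1 + Real.log (e + 1) := by
    rcases Nat.eq_zero_or_pos E.card with h0 | h0
    · rw [h0]
      have : 0 ≤ Real.log ((e : ℝ) + 1) := Real.log_nonneg (by linarith [e.cast_nonneg (α := ℝ)])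
      simp only [harmonic_zero, Rat.cast_zero]
      linarith
    · refine (harmonic_le_one_add_log _).trans ?_
      have : (E.card : ℝ) ≤ e + 1 := by exact_mod_cast hc.trans (Nat.le_succ e)
      have := Real.log_le_log (by exact_mod_cast h0) this
      linarith
  calc 4 / (1 / (2 * cfQ α (n + 1) : ℝ)) * (harmonic E.card : ℝ)
      = 8 * cfQ α (n + 1) * (harmonic E.card : ℝ) := by field_simp; ring
    _ ≤ _ := by gcongr

lemma oddPole_bounds {M t : ℕ} {z : ℤ} {x : ℝ} (ht : t < M)
    (h1 : (t : ℝ) + 1 < (M + 4) * (x - z)) (h2 : (M + 4) * (x - z) < (t : ℝ) + 4) :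
    oddPole x ≤ (M + 4) * (1 / ((M : ℝ) - t) - 1 / ((t : ℝ) + 4)) ∧
      -oddPole x ≤ (M + 4) * (1 / ((t : ℝ) + 1) - 1 / ((M : ℝ) - t + 3)) := by
  have htM : (t : ℝ) + 1 ≤ M := by exact_mod_cast ht
  have ht0 : (0 : ℝ) ≤ t := t.cast_nonneg
  have hQ : (0 : ℝ) < M + 4 := by linarith
  have hx0 : 0 < x - z := by
    by_contra hcon
    nlinarith
  have hx1 : x - z < 1 := by
    by_contra hcon
    nlinarith
  have hf : Int.fract x = x - z :=
    Int.fract_eq_iff.2 ⟨hx0.le, hx1, z, by ring⟩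
  have hy0 : 0 < 1 - (x - z) := by linarith
  rw [oddPole, hf]
  have b1 : 1 / (1 - (x - z)) ≤ (M + 4) * (1 / ((M : ℝ) - t)) := by
    rw [mul_one_div, div_le_div_iff₀ hy0 (by linarith)]
    linarith
  have b2 : (M + 4) * (1 / ((t : ℝ) + 4)) ≤ 1 / (x - z) := by
    rw [mul_one_div, div_le_div_iff₀ (by linarith) hx0]
    linarith
  have b3 : 1 / (x - z) ≤ (M + 4) * (1 / ((t : ℝ) + 1)) := by
    rw [mul_one_div, div_le_div_iff₀ hx0 (by linarith)]
    linarith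
  have b4 : (M + 4) * (1 / ((M : ℝ) - t + 3)) ≤ 1 / (1 - (x - z)) := by
    rw [mul_one_div, div_le_div_iff₀ (by linarith) hy0]
    linarith
  rw [mul_sub, mul_sub]
  constructor <;> linarith

lemma sum_telescope_le (M : ℕ) :
    ∑ t ∈ Finset.range M, (1 / ((t : ℝ) + 1) - 1 / ((t : ℝ) + 4)) ≤ 2 := by
  have key : ∑ t ∈ Finset.range M, (1 / ((t : ℝ) + 1) - 1 / ((t : ℝ) + 4)) =
      11 / 6 - 1 / ((M : ℝ) + 1) - 1 / ((M : ℝ) + 2) - 1 / ((M : ℝ) + 3) := by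
    induction M with
    | zero => norm_num
    | succ M ih =>
      rw [Finset.sum_range_succ, ih]
      push_cast
      ring
  have : (0 : ℝ) < 1 / ((M : ℝ) + 1) := by positivity
  have : (0 : ℝ) < 1 / ((M : ℝ) + 2) := by positivity
  have : (0 : ℝ) < 1 / ((M : ℝ) + 3) := by positivity
  linarith

lemma sum_reflected_le (M : ℕ) :
    ∑ t ∈ Finset.range M, (1 / ((M : ℝ) - t) - 1 / ((t : ℝ) + 4)) ≤ 2 ∧
      ∑ t ∈ Finset.range M, (1 / ((t : ℝ) + 1) - 1 / ((M : ℝ) - t + 3)) ≤ 2 := by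
  have h := sum_telescope_le M
  have r1 := Finset.sum_range_reflect (fun t : ℕ => 1 / ((t : ℝ) + 1)) M
  have r2 := Finset.sum_range_reflect (fun t : ℕ => 1 / ((t : ℝ) + 4)) M
  have c : ∀ t ∈ Finset.range M, ((M - 1 - t : ℕ) : ℝ) = M - 1 - t := by
    intro t ht
    have := Finset.mem_range.1 ht
    rw [Nat.cast_sub (by omega), Nat.cast_sub (by omega)]
    simp
  have e1 : ∑ t ∈ Finset.range M, 1 / ((M : ℝ) - t) =
      ∑ t ∈ Finset.range M, 1 / ((t : ℝ) + 1) := by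
    rw [← r1]
    refine Finset.sum_congr rfl fun t ht => ?_
    rw [c t ht]
    congr 1
    ring
  have e2 : ∑ t ∈ Finset.range M, 1 / ((M : ℝ) - t + 3) =
      ∑ t ∈ Finset.range M, 1 / ((t : ℝ) + 4) := by
    rw [← r2]
    refine Finset.sum_congr rfl fun t ht => ?_
    rw [c t ht]
    congr 1
    ring
  rw [Finset.sum_sub_distrib] at h
  rw [Finset.sum_sub_distrib, Finset.sum_sub_distrib, e1, e2]
  exact ⟨h, h⟩

/-- Cancellation over one period of a rational approximation, away from four points. -/
lemma sumExcept_period {α : ℝ} {q : ℕ} {p : ℤ} (hcop : IsCoprime p (q : ℤ))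
    (herr : |q * α - p| ≤ 1 / (q : ℝ)) (y : ℝ) : SumExcept oddPole α q 4 (2 * q) y := by
  rcases le_or_gt q 4 with hq4 | hq4
  · exact ⟨Finset.range q, subset_rfl, by simpa using hq4, by simp⟩
  obtain ⟨M, rfl⟩ : ∃ M, q = M + 4 := ⟨q - 4, by omega⟩
  set q := M + 4 with hqM
  have hqR : (q : ℝ) = M + 4 := by rw [hqM]; push_cast; ring
  have hq0 : (0 : ℝ) < q := by rw [hqR]; positivity
  have hqZ : (0 : ℤ) < q := by omega
  let N : ℕ → ℤ := fun i => ⌊q * y⌋ + i * p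
  let j : ℕ → ℕ := fun i => (N i % q).toNat
  have hj : ∀ i, (j i : ℤ) = N i % q := fun i =>
    Int.toNat_of_nonneg (Int.emod_nonneg _ hqZ.ne')
  have hjlt : ∀ i, j i < q := fun i => by
    have := Int.emod_lt_of_pos (N i) hqZ
    rw [← hj] at this
    exact_mod_cast this
  have hinj : Set.InjOn j (Finset.range q) := by
    intro a ha b hb hab
    have h1 : N a ≡ N b [ZMOD q] := by
      have : (j a : ℤ) = j b := by rw [hab]
      rwa [hj, hj] at this
    have h2 : (q : ℤ) ∣ (b - a) * p := by
      have := h1.dvd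
      rwa [show N b - N a = (b - a) * p by simp only [N]; ring] at this
    have h3 : (q : ℤ) ∣ (b : ℤ) - a := hcop.symm.dvd_of_dvd_mul_right h2
    have ha' := Finset.mem_range.1 ha
    have hb' := Finset.mem_range.1 hb
    have := Int.eq_zero_of_abs_lt_dvd h3 (by rw [abs_lt]; constructor <;> omega)
    omega
  have hsurj : (Finset.range q).image j = Finset.range q := by
    refine Finset.eq_of_subset_of_card_le ?_ (by rw [Finset.card_image_of_injOn hinj])
    intro a ha
    obtain ⟨i, -, rfl⟩ := Finset.mem_image.1 ha
    exact Finset.mem_range.2 (hjlt i)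
  have hsum : ∀ h : ℕ → ℝ, ∑ i ∈ Finset.range q with 2 ≤ j i ∧ j i < M + 2, h (j i - 2) =
      ∑ t ∈ Finset.range M, h t := by
    intro h
    refine Finset.sum_nbij (fun i => j i - 2) ?_ ?_ ?_ fun _ _ => rfl
    · intro i hi
      have := (Finset.mem_filter.1 hi).2
      exact Finset.mem_range.2 (by omega)
    · intro a ha b hb hab
      have ha' := Finset.mem_filter.1 ha
      have hb' := Finset.mem_filter.1 hb
      simp only at hab
      exact hinj ha'.1 hb'.1 (by omega)
    · intro t ht
      have ht' := Finset.mem_range.1 ht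
      have : t + 2 ∈ (Finset.range q).image j := by
        rw [hsurj]; exact Finset.mem_range.2 (by omega)
      obtain ⟨i, hi, hit⟩ := Finset.mem_image.1 this
      exact ⟨i, Finset.mem_filter.2 ⟨hi, by omega, by omega⟩, by simp only; omega⟩
  have hpt : ∀ i ∈ Finset.range q, 2 ≤ j i ∧ j i < M + 2 →
      oddPole (y + i * α) ≤
          q * (1 / ((M : ℝ) - (j i - 2 : ℕ)) - 1 / (((j i - 2 : ℕ) : ℝ) + 4)) ∧
        -oddPole (y + i * α) ≤
          q * (1 / (((j i - 2 : ℕ) : ℝ) + 1) - 1 / ((M : ℝ) - (j i - 2 : ℕ) + 3)) := by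
    rintro i hi ⟨hi1, hi2⟩
    have hiq : (i : ℝ) < q := by exact_mod_cast Finset.mem_range.1 hi
    have hi0 : (0 : ℝ) ≤ i := i.cast_nonneg
    have hθ : |i * (q * α - p)| < 1 := by
      rw [abs_mul, abs_of_nonneg hi0]
      calc (i : ℝ) * |q * α - p| ≤ i * (1 / (q : ℝ)) := by gcongr
        _ = i / q := by ring
        _ < 1 := (div_lt_one hq0).2 hiq
    have hdiv : ((N i / q : ℤ) : ℝ) * q + j i = ⌊q * y⌋ + i * p := by
      have h := Int.emod_add_mul_ediv (N i) q
      rw [← hj] at h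
      have h' : ((j i + q * (N i / q) : ℤ) : ℝ) = (N i : ℤ) := by rw [h]
      simp only [N] at h' ⊢
      push_cast at h'
      linarith
    have hcast : ((j i - 2 : ℕ) : ℝ) = j i - 2 := by
      rw [Nat.cast_sub hi1]; simp
    have f1 := Int.floor_le ((q : ℝ) * y)
    have f2 := Int.lt_floor_add_one ((q : ℝ) * y)
    have g1 := (abs_lt.1 hθ).1
    have g2 := (abs_lt.1 hθ).2
    rw [hqR] at *
    refine oddPole_bounds (z := N i / q) (by omega) ?_ ?_
    · rw [hcast]
      linarith
    · rw [hcast]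
      linarith
  refine ⟨(Finset.range q).filter fun i => ¬(2 ≤ j i ∧ j i < M + 2),
    Finset.filter_subset _ _, ?_, ?_⟩
  · have hmaps : Set.MapsTo j ((Finset.range q).filter fun i => ¬(2 ≤ j i ∧ j i < M + 2))
        ({0, 1, M + 2, M + 3} : Finset ℕ) := by
      intro i hi
      have h1 := (Finset.mem_filter.1 hi).2
      have h2 := hjlt i
      simp only [Finset.coe_insert, Finset.coe_singleton, Set.mem_insert_iff,
        Set.mem_singleton_iff]
      omega
    exact (Finset.card_le_card_of_injOn j hmaps
      (hinj.mono (Finset.coe_subset.2 (Finset.filter_subset _ _)))).trans Finset.card_le_four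
  · have hset : Finset.range q \ ((Finset.range q).filter fun i => ¬(2 ≤ j i ∧ j i < M + 2)) =
        (Finset.range q).filter fun i => 2 ≤ j i ∧ j i < M + 2 := by
      ext a
      simp only [Finset.mem_sdiff, Finset.mem_filter]
      tauto
    rw [hset]
    obtain ⟨s1, s2⟩ := sum_reflected_le M
    have u1 : ∑ i ∈ Finset.range q with 2 ≤ j i ∧ j i < M + 2, oddPole (y + i * α) ≤ q * 2 := by
      refine le_trans (Finset.sum_le_sum fun i hi =>
        (hpt i (Finset.mem_filter.1 hi).1 (Finset.mem_filter.1 hi).2).1) ?_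
      rw [← Finset.mul_sum, hsum fun t => 1 / ((M : ℝ) - t) - 1 / ((t : ℝ) + 4)]
      gcongr
    have u2 : ∑ i ∈ Finset.range q with 2 ≤ j i ∧ j i < M + 2, -oddPole (y + i * α) ≤
        q * 2 := by
      refine le_trans (Finset.sum_le_sum fun i hi =>
        (hpt i (Finset.mem_filter.1 hi).1 (Finset.mem_filter.1 hi).2).2) ?_
      rw [← Finset.mul_sum, hsum fun t => 1 / ((t : ℝ) + 1) - 1 / ((M : ℝ) - t + 3)]
      gcongr
    rw [Finset.sum_neg_distrib] at u2
    rw [abs_le]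
    constructor <;> linarith

lemma SumExcept.mono {φ : ℝ → ℝ} {α y B B' : ℝ} {l e e' : ℕ} (h : SumExcept φ α l e B y)
    (he : e ≤ e') (hB : B ≤ B') : SumExcept φ α l e' B' y := by
  obtain ⟨E, hE, hc, hs⟩ := h
  exact ⟨E, hE, hc.trans he, hs.trans hB⟩

/-- Orbit sums of length at most `q_n` are controlled up to one exceptional point. -/
lemma sumExcept_oddPole {α : ℝ} (hirr : Irrational α) (hα : α ∈ Set.Ioo (0 : ℝ) 1) (n : ℕ) :
    ∀ (y : ℝ) (l : ℕ), l ≤ cfQ α n → SumExcept oddPole α l 1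
      (∑ j ∈ Finset.range n, (cfQ α (j + 1) : ℝ) * (36 + 8 * Real.log (cfA α (j + 1)))) y := by
  induction n with
  | zero =>
    intro y l hl
    exact ⟨Finset.range l, subset_rfl, by simpa [cfQ] using hl, by simp⟩
  | succ n ih =>
    intro y l hl
    have hq := cfQ_pos hirr n
    set b := l / cfQ α n with hb
    have hblock := SumExcept.of_blocks
      (sumExcept_period (convergent_coprime α n) (abs_convergent_error_le hirr hα n)) b y
    have htail := ih (y + (b * cfQ α n : ℕ) * α) (l % cfQ α n) (Nat.mod_lt _ hq).le
    have hall := hblock.append htail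
    rw [hb, mul_comm, Nat.div_add_mod, ← hb] at hall
    refine (hall.reduce hirr hα hl).mono le_rfl ?_
    rw [Finset.sum_range_succ]
    have ha := one_le_cfA hirr n
    have haR : (1 : ℝ) ≤ cfA α (n + 1) := by exact_mod_cast ha
    have hba : b ≤ cfA α (n + 1) + 1 :=
      Nat.div_le_of_le_mul ((hl.trans (cfQ_succ_le hirr n)).trans_eq (mul_comm _ _))
    have hbq : (b : ℝ) * cfQ α n ≤ cfQ α (n + 1) := by
      exact_mod_cast (Nat.div_mul_le_self l (cfQ α n)).trans hl
    have hlog : Real.log (((b * 4 + 1 : ℕ) : ℝ) + 1) ≤ 3 + Real.log (cfA α (n + 1)) := by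
      have h1 : ((b * 4 + 1 : ℕ) : ℝ) + 1 ≤ Real.exp 3 * cfA α (n + 1) := by
        have h2 : (b : ℝ) ≤ cfA α (n + 1) + 1 := by exact_mod_cast hba
        have h3 : (10 : ℝ) ≤ Real.exp 3 := by
          have e1 := Real.exp_one_gt_d9
          have e3 : Real.exp 3 = Real.exp 1 * Real.exp 1 * Real.exp 1 := by
            rw [← Real.exp_add, ← Real.exp_add]; norm_num
          rw [e3]
          nlinarith [mul_pos (Real.exp_pos 1) (Real.exp_pos 1)]
        push_cast
        nlinarith
      refine (Real.log_le_log (by positivity) h1).trans_eq ?_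
      rw [Real.log_mul (Real.exp_pos 3).ne' (by linarith), Real.log_exp]
    have hq1 : (0 : ℝ) ≤ cfQ α (n + 1) := Nat.cast_nonneg _
    have := mul_le_mul_of_nonneg_left hlog hq1
    nlinarith

/-- The derivative of a `C¹` periodic function is bounded. -/
lemma exists_abs_deriv_le {g : ℝ → ℝ} (hgper : Function.Periodic g 1) (hg : ContDiff ℝ 1 g) :
    ∃ G : ℝ, 0 ≤ G ∧ ∀ y, |deriv g y| ≤ G := by
  have hper : Function.Periodic (deriv g) 1 := by
    intro y
    rw [← deriv_comp_add_const]
    congr 1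
    exact funext hgper
  obtain ⟨G, hG⟩ := (hper.isBounded_of_continuous one_ne_zero
    (hg.continuous_deriv le_rfl)).exists_norm_le
  have h : ∀ y, |deriv g y| ≤ G := fun y => hG _ ⟨y, rfl⟩
  exact ⟨G, (abs_nonneg _).trans (h 0), h⟩

/-- Let `α ∈ 𝒞_{K,L}` with associated increasing sequence `(n_k)` and
constant `c > 0`, and let `f(x) = -log x - log(1-x) + g(x)` with `g ∈ C³(𝕋)`. For every
`c'' > 0` there is `C'' > 0` such that for every `k`, every `x` whose `q_{n_k}`-orbit
avoids the interval `[-c''/q_{n_k}, c''/q_{n_k}]` of `𝕋`, and every `0 ≤ ℓ ≤ q_{n_k}`,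
`|S_ℓ(f')(x)| ≤ C'' q_{n_k}`. -/
theorem statement9 (K L : ℕ)
    (α : ℝ) (hirr : Irrational α) (hα : α ∈ Set.Ioo (0 : ℝ) 1)
    (nk : ℕ → ℕ) (hnk : StrictMono nk) (c : ℝ) (hc : 0 < c)
    (hdio1 : ∀ k n : ℕ, 1 ≤ n → n ≤ nk k →
      (cfA α (nk k + 1 - n) : ℝ) ≤ Real.exp (c * n))
    (hdio2 : ∀ k : ℕ, 100 * (K ^ 2 + L ^ 2) < cfA α (nk k + 1) ∧
      cfA α (nk k + 1) < 200 * (K ^ 2 + L ^ 2))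
    (g : ℝ → ℝ) (hgper : Function.Periodic g 1) (hg : ContDiff ℝ 3 g) :
    ∀ c'' > (0 : ℝ), ∃ C'' > (0 : ℝ), ∀ k : ℕ, ∀ x : ℝ,
      (∀ j : ℕ, j < cfQ α (nk k) →
        c'' / cfQ α (nk k) < distNearestInt (x + j * α)) →
      ∀ l : ℕ, l ≤ cfQ α (nk k) →
        |birkhoffRot α (fun y => 1 / (1 - Int.fract y) - 1 / Int.fract y + deriv g y) l x|
          ≤ C'' * cfQ α (nk k) := by
  intro c'' hc''
  obtain ⟨G, hG0, hG⟩ := exists_abs_deriv_le hgper (hg.of_le (by norm_num))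
  refine ⟨(36 + 8 * c) * 9 + 1 / c'' + G, by positivity, ?_⟩
  intro k x hx l hl
  set n := nk k with hn
  have hq : (1 : ℝ) ≤ cfQ α n := by exact_mod_cast cfQ_pos hirr n
  have hlR : (l : ℝ) ≤ cfQ α n := by exact_mod_cast hl
  have hweights : ∑ j ∈ Finset.range n,
      (cfQ α (j + 1) : ℝ) * (36 + 8 * Real.log (cfA α (j + 1))) ≤
        (36 + 8 * c) * (9 * cfQ α n) := by
    refine le_trans (Finset.sum_le_sum (g := fun j : ℕ =>
      (36 + 8 * c) * (((n : ℝ) - j) * cfQ α (j + 1))) fun j hj => ?_) ?_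
    · have hjn := Finset.mem_range.1 hj
      have h := hdio1 k (n - j) (by omega) (by omega)
      rw [← hn, show n + 1 - (n - j) = j + 1 by omega, Nat.cast_sub hjn.le] at h
      have ha : (1 : ℝ) ≤ cfA α (j + 1) := by exact_mod_cast one_le_cfA hirr j
      have hlog : Real.log (cfA α (j + 1)) ≤ c * ((n : ℝ) - j) := by
        rwa [Real.log_le_iff_le_exp (by linarith)]
      have hnj : (1 : ℝ) ≤ (n : ℝ) - j := by
        have : (j : ℝ) + 1 ≤ n := by exact_mod_cast hjn
        linarith
      calc (cfQ α (j + 1) : ℝ) * (36 + 8 * Real.log (cfA α (j + 1)))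
          ≤ cfQ α (j + 1) * ((36 + 8 * c) * ((n : ℝ) - j)) := by
            gcongr
            linarith
        _ = _ := by ring
    · rw [← Finset.mul_sum]
      have := sum_weighted_cfQ_le hirr n
      gcongr
  obtain ⟨E, hE, hcard, hsum⟩ := sumExcept_oddPole hirr hα n x l hl
  have hexc : |∑ i ∈ E, oddPole (x + i * α)| ≤ 1 / c'' * cfQ α n := by
    have hone : ∀ i ∈ E, |oddPole (x + i * α)| ≤ 1 / c'' * cfQ α n := by
      intro i hi
      have h1 := hx i ((Finset.mem_range.1 (hE hi)).trans_le hl)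
      rw [distNearestInt, ← abs_sub_round_eq_min] at h1
      have h0 : 0 < c'' / (cfQ α n : ℝ) := by positivity
      refine (abs_oddPole_le (abs_pos.1 (h0.trans h1))).trans ?_
      refine (one_div_le_one_div_of_le h0 h1.le).trans_eq ?_
      field_simp
    refine (Finset.abs_sum_le_sum_abs _ _).trans ((Finset.sum_le_card_nsmul _ _ _ hone).trans ?_)
    rw [nsmul_eq_mul]
    have : (E.card : ℝ) ≤ 1 := by exact_mod_cast hcard
    exact mul_le_of_le_one_left (by positivity) this
  have hsmooth : |∑ i ∈ Finset.range l, deriv g (x + i * α)| ≤ G * cfQ α n := by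
    refine (Finset.abs_sum_le_sum_abs _ _).trans
      ((Finset.sum_le_card_nsmul _ _ _ fun i _ => hG _).trans ?_)
    rw [Finset.card_range, nsmul_eq_mul, mul_comm]
    gcongr
  have hsplit : birkhoffRot α (fun y => 1 / (1 - Int.fract y) - 1 / Int.fract y + deriv g y) l x =
      ∑ i ∈ Finset.range l \ E, oddPole (x + i * α) + ∑ i ∈ E, oddPole (x + i * α) +
        ∑ i ∈ Finset.range l, deriv g (x + i * α) := by
    rw [Finset.sum_sdiff hE, ← Finset.sum_add_distrib]
    rfl
  rw [hsplit]
  refine (abs_add_three _ _ _).trans ?_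
  linarith
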